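/- arXiv:1301.1218 — 8 statements merged into one kernel-verified Lean document; each statement's English description precedes it below -/
import Mathlib

section
/- Let C be a collection of itemsets over a finite ground set I and let R(C) be its associated range set. If a finite set F of pairwise distinct transactions is shattered by R(C), then F is an antichain with respect to set inclusion: no transaction in F is a proper subset of another transaction in F. -/
/-- The support set of an itemset `A`: all transactions (subsets of the ground set)
containing `A`. -/
def supp {α : Type*} (A : Finset α) : Set (Finset α) := {τ | A ⊆ τ}

/-- The range set associated to a collection `C` of itemsets. -/
def rangeSet {α : Type*} (C : Set (Finset α)) : Set (Set (Finset α)) :=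
  {s | ∃ A ∈ C, s = supp A}

/-- A finite set `F` is shattered by a range set `R` if every subset of `F` is cut out
by some range. -/
def ShatteredBy {Ω : Type*} (R : Set (Set Ω)) (F : Finset Ω) : Prop :=
  ∀ K ⊆ F, ∃ r ∈ R, r ∩ ↑F = ↑K

/-- If a finite set `F` of pairwise distinct transactions is shattered by the
range set `R(C)` of a collection `C` of itemsets over a finite ground set, then `F` is an
antichain: no transaction in `F` is a proper subset of another transaction in `F`. -/
theorem stmt0 {α : Type*} [Fintype α] [DecidableEq α] (C : Set (Finset α))
    (F : Finset (Finset α)) (h : ShatteredBy (rangeSet C) F) :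
    ∀ τ₁ ∈ F, ∀ τ₂ ∈ F, ¬ τ₁ ⊂ τ₂ := by
  intro τ₁ h₁ τ₂ h₂ hlt
  obtain ⟨_, ⟨A, _, rfl⟩, hA⟩ := h {τ₁} (Finset.singleton_subset_iff.mpr h₁)
  have hsub : A ⊆ τ₁ := (hA.ge (by simp : τ₁ ∈ (({τ₁} : Finset (Finset α)) : Set (Finset α)))).1
  have hmem : τ₂ ∈ supp A ∩ (F : Set (Finset α)) := ⟨hsub.trans hlt.subset, h₂⟩
  rw [hA, Finset.mem_coe, Finset.mem_singleton] at hmem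
  exact hlt.ne hmem.symm
end

section
/- Let C be a collection of itemsets over a finite ground set I and let R(C) be its associated range set. If a finite set L of pairwise distinct transactions is shattered by R(C), then every transaction τ ∈ L contains at least 2^{|L|−1} distinct itemsets from C, that is, |{A ∈ C : A ⊆ τ}| ≥ 2^{|L|−1}. -/
/-- If a finite set `L` of pairwise distinct transactions is shattered by the
range set `R(C)`, then every transaction `τ ∈ L` contains at least `2^(|L|-1)` distinct
itemsets from `C`. -/
theorem stmt1 {α : Type*} [Fintype α] [DecidableEq α] (C : Finset (Finset α))
    (L : Finset (Finset α)) (h : ShatteredBy (rangeSet ↑C) L) :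
    ∀ τ ∈ L, 2 ^ (L.card - 1) ≤ (C.filter (fun A => A ⊆ τ)).card := by
  intro τ hτ
  rw [← Finset.card_erase_of_mem hτ, ← Finset.card_powerset]
  refine Finset.card_le_card_of_surjOn (fun A => (L.erase τ).filter (A ⊆ ·)) ?_
  intro K hK
  have hK : K ⊆ L.erase τ := Finset.mem_powerset.mp (Finset.mem_coe.mp hK)
  have hKL : insert τ K ⊆ L :=
    Finset.insert_subset hτ (hK.trans (Finset.erase_subset _ _))
  obtain ⟨_, ⟨A, hA, rfl⟩, hAK⟩ := h _ hKL
  have key (σ : Finset α) : (A ⊆ σ ∧ σ ∈ L) ↔ σ = τ ∨ σ ∈ K := by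
    simpa [supp] using Set.ext_iff.mp hAK σ
  refine ⟨A, ?_, ?_⟩
  · simpa using And.intro (Finset.mem_coe.mp hA) ((key τ).mpr (Or.inl rfl)).1
  · ext σ
    have hσ := key σ
    have hσK := @hK σ
    simp only [Finset.mem_filter, Finset.mem_erase] at hσK ⊢
    tauto
end

section
/- Let C be a collection of itemsets over a finite ground set I, let D be a dataset, and let d be a nonnegative integer such that for every integer ℓ > d there do not exist ℓ pairwise distinct transactions of D that form an antichain and each of which contains at least 2^{ℓ−1} distinct itemsets from C. Then the empirical VC-dimension of R(C) on D satisfies EVC(R(C), D) ≤ d. -/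
/-- A finite family of sets is an antichain: no member is a proper subset of another. -/
def IsAntichainF {α : Type*} (F : Finset (Finset α)) : Prop :=
  ∀ τ₁ ∈ F, ∀ τ₂ ∈ F, ¬ τ₁ ⊂ τ₂

open Classical in
/-- The empirical VC-dimension of a range set `R` on a dataset (bag of transactions) `D`:
the size of the largest set of distinct elements of `D` shattered by `R`. -/
noncomputable def EVC {Ω : Type*} [DecidableEq Ω] (R : Set (Set Ω)) (D : Multiset Ω) : ℕ :=
  (D.toFinset.powerset.filter (fun F => ShatteredBy R F)).sup Finset.card

theorem ShatteredBy.exists_forall_subset_iff {α : Type*} {C : Set (Finset α)}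
    {F : Finset (Finset α)} (hF : ShatteredBy (rangeSet C) F) {K : Finset (Finset α)}
    (hK : K ⊆ F) : ∃ A ∈ C, ∀ τ ∈ F, A ⊆ τ ↔ τ ∈ K := by
  obtain ⟨_, ⟨A, hA, rfl⟩, h⟩ := hF K hK
  refine ⟨A, hA, fun τ hτ => ?_⟩
  simpa [supp, hτ] using Set.ext_iff.1 h τ

theorem ShatteredBy.isAntichainF {α : Type*} {C : Set (Finset α)} {F : Finset (Finset α)}
    (hF : ShatteredBy (rangeSet C) F) : IsAntichainF F := by
  intro τ₁ h₁ τ₂ h₂ hlt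
  obtain ⟨A, -, hA⟩ := hF.exists_forall_subset_iff (Finset.singleton_subset_iff.2 h₁)
  have h₂₁ : τ₂ = τ₁ := Finset.mem_singleton.1 <|
    (hA τ₂ h₂).1 (((hA τ₁ h₁).2 (Finset.mem_singleton_self _)).trans hlt.1)
  exact hlt.ne h₂₁.symm

theorem ShatteredBy.two_pow_le_card_filter {α : Type*} [DecidableEq α] {C : Finset (Finset α)}
    {F : Finset (Finset α)} (hF : ShatteredBy (rangeSet ↑C) F) {τ : Finset α} (hτ : τ ∈ F) :
    2 ^ (F.card - 1) ≤ (C.filter (fun A => A ⊆ τ)).card := by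
  rw [← Finset.card_erase_of_mem hτ, ← Finset.card_powerset]
  refine Finset.card_le_card_of_surjOn (fun A => (F.erase τ).filter (fun σ => A ⊆ σ))
    fun K hK => ?_
  have hKF : K ⊆ F.erase τ := Finset.mem_powerset.1 hK
  obtain ⟨A, hA, hAK⟩ := hF.exists_forall_subset_iff
    (Finset.insert_subset hτ (hKF.trans (Finset.erase_subset _ _)))
  refine ⟨A, ?_, ?_⟩
  · simpa using ⟨hA, (hAK τ hτ).2 (Finset.mem_insert_self _ _)⟩
  · ext σ
    grind

/-- If for every `ℓ > d` there do not exist `ℓ` pairwise distinct transactions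
of `D` forming an antichain, each containing at least `2^(ℓ-1)` distinct itemsets from `C`,
then `EVC(R(C), D) ≤ d`. -/
theorem stmt2 {α : Type*} [Fintype α] [DecidableEq α] (C : Finset (Finset α))
    (D : Multiset (Finset α)) (d : ℕ)
    (h : ∀ ℓ : ℕ, d < ℓ →
      ¬ ∃ F : Finset (Finset α), F.card = ℓ ∧ (∀ τ ∈ F, τ ∈ D) ∧ IsAntichainF F ∧
        ∀ τ ∈ F, 2 ^ (ℓ - 1) ≤ (C.filter (fun A => A ⊆ τ)).card) :
    EVC (rangeSet ↑C) D ≤ d := by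
  refine Finset.sup_le fun F hF => ?_
  obtain ⟨hFD, hF⟩ := (@Finset.mem_filter _ _ (_) _ _).1 hF
  rw [Finset.mem_powerset] at hFD
  by_contra! hd
  exact h F.card hd ⟨F, rfl, fun τ hτ => Multiset.mem_toFinset.1 (hFD hτ), hF.isAntichainF,
    fun τ hτ => hF.two_pow_le_card_filter hτ⟩
end

section
/- Let C be a finite nonempty collection of itemsets over a finite ground set I, let U = {a ∈ I : there exists A ∈ C with a ∈ A} be the set of items appearing in at least one itemset of C, and let q = max{|S'| : S' ⊆ C, |⋃_{A∈S'} A| ≤ |U|} be the optimal profit of the SUKP associated to C with capacity |U|. Let b = ⌊log_2 q⌋ + 1. Then VC(R(C)) ≤ b. -/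
open Classical in
/-- The VC-dimension of a range set `R` on the domain `2^I` (all subsets of the finite
ground set): the size of the largest finite set of transactions shattered by `R`. -/
noncomputable def VCdim {Ω : Type*} [Fintype Ω] [DecidableEq Ω] (R : Set (Set Ω)) : ℕ :=
  ((Finset.univ : Finset (Finset Ω)).filter (fun F => ShatteredBy R F)).sup Finset.card

/-- The optimal profit of the SUKP associated to `C` with unit profits and weights and
capacity `ℓ`. -/
def sukpProfit {α : Type*} [DecidableEq α] (C : Finset (Finset α)) (ℓ : ℕ) : ℕ :=
  (C.powerset.filter (fun S => (S.sup id).card ≤ ℓ)).sup Finset.card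

/-- A set shattered by the range set of `C` has at most `|C|` subsets. -/
theorem ShatteredBy.two_pow_card_le {α : Type*} {C : Finset (Finset α)}
    {F : Finset (Finset α)} (hF : ShatteredBy (rangeSet (↑C : Set (Finset α))) F) :
    2 ^ F.card ≤ C.card := by
  classical
  rw [← Finset.card_powerset]
  apply Finset.card_le_card_of_surjOn fun A => F.filter (· ∈ supp A)
  intro K hK
  obtain ⟨r, ⟨A, hA, rfl⟩, hr⟩ := hF K (Finset.mem_powerset.mp hK)
  refine ⟨A, hA, Finset.coe_injective ?_⟩
  rw [← hr]
  ext τ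
  simp [and_comm]

/-- If all items of `C` lie in `U`, then capacity `|U|` accommodates the whole of `C`. -/
theorem card_le_sukpProfit {α : Type*} [DecidableEq α] {C : Finset (Finset α)}
    {U : Finset α} (hU : ∀ A ∈ C, A ⊆ U) : C.card ≤ sukpProfit C U.card :=
  Finset.le_sup (f := Finset.card) <| Finset.mem_filter.mpr
    ⟨Finset.mem_powerset_self C, Finset.card_le_card (Finset.sup_le hU)⟩

/-- Let `U` be the set of items appearing in at least one itemset of the
nonempty finite collection `C`, let `q` be the optimal profit of the SUKP associated to `C`
with capacity `|U|`, and let `b = ⌊log₂ q⌋ + 1`. Then `VC(R(C)) ≤ b`. -/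
theorem stmt5 {α : Type*} [Fintype α] [DecidableEq α] (C : Finset (Finset α))
    (hC : C.Nonempty) (U : Finset α) (hU : ∀ a : α, a ∈ U ↔ ∃ A ∈ C, a ∈ A)
    (q : ℕ) (hq : q = sukpProfit C U.card)
    (b : ℕ) (hb : b = Nat.log 2 q + 1) :
    VCdim (rangeSet (↑C : Set (Finset α))) ≤ b := by
  classical
  subst hq hb
  refine Finset.sup_le fun F hF => ?_
  have hCq := card_le_sukpProfit fun A hA a ha => (hU a).mpr ⟨A, hA, ha⟩
  exact (Nat.le_log_of_pow_le one_lt_two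
    ((Finset.mem_filter.mp hF).2.two_pow_card_le.trans hCq)).trans (Nat.le_succ _)
end

section
/- Let I be a finite ground set and let R(2^I) be the range set of the collection of all itemsets over I. If a finite set L of pairwise distinct transactions is shattered by R(2^I), then L is an antichain and every transaction τ ∈ L has length |τ| ≥ |L| − 1. -/
/-- Shattering by supports of itemsets, unfolded: every `K ⊆ L` consists of exactly those
members of `L` that contain some fixed itemset. -/
theorem ShatteredBy.exists_itemset {α : Type*} {L : Finset (Finset α)}
    (h : ShatteredBy (rangeSet (Set.univ : Set (Finset α))) L)
    {K : Finset (Finset α)} (hK : K ⊆ L) :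
    ∃ A : Finset α, ∀ τ ∈ L, A ⊆ τ ↔ τ ∈ K := by
  obtain ⟨_, ⟨A, -, rfl⟩, hA⟩ := h K hK
  refine ⟨A, fun τ hτ => ?_⟩
  have := Set.ext_iff.mp hA τ
  simpa [supp, hτ] using this

/-- Every member of a shattered family misses an item common to all other members. -/
theorem ShatteredBy.exists_missing_item {α : Type*} [DecidableEq α] {L : Finset (Finset α)}
    (h : ShatteredBy (rangeSet (Set.univ : Set (Finset α))) L)
    {σ : Finset α} (hσ : σ ∈ L) :
    ∃ x ∉ σ, ∀ τ ∈ L, τ ≠ σ → x ∈ τ := by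
  obtain ⟨A, hA⟩ := h.exists_itemset (L.erase_subset σ)
  have hAσ : ¬ A ⊆ σ := by simp [hA σ hσ]
  obtain ⟨x, hxA, hxσ⟩ := Finset.not_subset.mp hAσ
  exact ⟨x, hxσ, fun τ hτ hne => (hA τ hτ).mpr (Finset.mem_erase.mpr ⟨hne, hτ⟩) hxA⟩

/-- If a finite set `L` of pairwise distinct transactions is shattered by the
range set `R(2^I)` of the collection of all itemsets, then `L` is an antichain and every
transaction `τ ∈ L` has length at least `|L| - 1`. -/
theorem stmt7 {α : Type*} [Fintype α] [DecidableEq α] (L : Finset (Finset α))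
    (h : ShatteredBy (rangeSet (Set.univ : Set (Finset α))) L) :
    IsAntichainF L ∧ ∀ τ ∈ L, L.card - 1 ≤ τ.card := by
  constructor
  · intro τ₁ h₁ τ₂ h₂ hlt
    obtain ⟨x, hx, hx'⟩ := h.exists_missing_item h₂
    exact hx (hlt.subset (hx' τ₁ h₁ hlt.ne))
  · intro τ hτ
    rw [← Finset.card_erase_of_mem hτ]
    refine Finset.card_le_card_of_forall_subsingleton
      (fun σ x => x ∉ σ ∧ ∀ ρ ∈ L, ρ ≠ σ → x ∈ ρ) (fun σ hσ => ?_) ?_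
    · obtain ⟨hne, hσL⟩ := Finset.mem_erase.mp hσ
      obtain ⟨x, hx, hx'⟩ := h.exists_missing_item hσL
      exact ⟨x, hx' τ hτ hne.symm, hx, hx'⟩
    · rintro x - σ ⟨hσ, hxσ, -⟩ ρ ⟨-, -, hx⟩
      by_contra hne
      exact hxσ (hx σ (Finset.mem_of_mem_erase hσ) hne)
end

section
/- Let π be a probability distribution on 2^I for a finite ground set I, let D be a dataset, let θ ∈ (0,1] and ε_1 ∈ (0, θ). Let B be the negative border of TFI(π, I, θ), let G = {A ⊆ I : θ − ε_1 ≤ f_D(A) < θ + ε_1}, and let W be the negative border of FI(D, I, θ − ε_1). If D is an ε_1-approximation to (R(2^I), π), i.e., |t_π(A) − f_D(A)| ≤ ε_1 for every itemset A ⊆ I, then B ⊆ G ∪ W; consequently EVC(R(B), D) ≤ EVC(R(G ∪ W), D) and VC(R(B)) ≤ VC(R(G ∪ W)). -/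
open MeasureTheory

/-- Transactions over a finite ground set form a finite type; we endow it with the
discrete (⊤) σ-algebra. -/
instance {α : Type*} : MeasurableSpace (Finset α) := ⊤

/-- The true frequency of an itemset `A` w.r.t. a probability distribution `π`. -/
noncomputable def trueFreq {α : Type*} (π : Measure (Finset α)) (A : Finset α) : ℝ :=
  (π {τ | A ⊆ τ}).toReal

/-- The frequency of an itemset `A` in a dataset `D`. -/
noncomputable def freq {α : Type*} [DecidableEq α] (D : Multiset (Finset α))
    (A : Finset α) : ℝ :=
  ((D.filter (fun τ => A ⊆ τ)).card : ℝ) / (D.card : ℝ)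

/-- The frequent itemsets of `D` w.r.t. threshold `η`. -/
def FI {α : Type*} [DecidableEq α] (D : Multiset (Finset α)) (η : ℝ) : Set (Finset α) :=
  {A | η ≤ freq D A}

/-- The true frequent itemsets of `π` w.r.t. threshold `η`. -/
def TFI {α : Type*} (π : Measure (Finset α)) (η : ℝ) : Set (Finset α) :=
  {A | η ≤ trueFreq π A}

/-- The negative border of a collection `T` of itemsets: the itemsets not in `T` all of
whose proper subsets belong to `T`. -/
def negBorder {α : Type*} (T : Set (Finset α)) : Set (Finset α) :=
  {A | A ∉ T ∧ ∀ B, B ⊂ A → B ∈ T}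

theorem rangeSet_mono {α : Type*} {C C' : Set (Finset α)} (h : C ⊆ C') :
    rangeSet C ⊆ rangeSet C' := by
  rintro s ⟨A, hA, rfl⟩
  exact ⟨A, h hA, rfl⟩

theorem ShatteredBy.mono {Ω : Type*} {R R' : Set (Set Ω)} (h : R ⊆ R') {F : Finset Ω}
    (hF : ShatteredBy R F) : ShatteredBy R' F := by
  intro K hK
  obtain ⟨r, hr, hrK⟩ := hF K hK
  exact ⟨r, h hr, hrK⟩

theorem EVC_mono {Ω : Type*} [DecidableEq Ω] {R R' : Set (Set Ω)} (h : R ⊆ R')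
    (D : Multiset Ω) : EVC R D ≤ EVC R' D := by
  classical
  exact Finset.sup_mono (Finset.monotone_filter_right _ fun _ _ hF => ShatteredBy.mono h hF)

theorem VCdim_mono {Ω : Type*} [Fintype Ω] [DecidableEq Ω] {R R' : Set (Set Ω)} (h : R ⊆ R') :
    VCdim R ≤ VCdim R' := by
  classical
  exact Finset.sup_mono (Finset.monotone_filter_right _ fun _ _ hF => ShatteredBy.mono h hF)

/-- If frequencies in `D` are within `ε` of the true ones, an itemset of the negative border of
`TFI π θ` either has frequency close to `θ` or lies in the negative border of `FI D (θ - ε)`. -/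
theorem negBorder_TFI_subset {α : Type*} [DecidableEq α] {π : Measure (Finset α)}
    {D : Multiset (Finset α)} {θ ε : ℝ}
    (happrox : ∀ A : Finset α, |trueFreq π A - freq D A| ≤ ε) :
    negBorder (TFI π θ) ⊆
      {A : Finset α | θ - ε ≤ freq D A ∧ freq D A < θ + ε} ∪ negBorder (FI D (θ - ε)) := by
  rintro A ⟨hA, hsub⟩
  have hlt : trueFreq π A < θ := not_le.mp hA
  by_cases hf : θ - ε ≤ freq D A
  · exact Or.inl ⟨hf, by linarith [(abs_le.mp (happrox A)).1]⟩
  · refine Or.inr ⟨hf, fun B hB => ?_⟩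
    have hle : θ ≤ trueFreq π B := hsub B hB
    change θ - ε ≤ freq D B
    linarith [(abs_le.mp (happrox B)).2]

/-- Let `B` be the negative border of `TFI(π, I, θ)`,
`G = {A : θ − ε₁ ≤ f_D(A) < θ + ε₁}`, and `W` the negative border of `FI(D, I, θ − ε₁)`.
If `D` is an `ε₁`-approximation to `(R(2^I), π)`, then `B ⊆ G ∪ W`, and consequently
`EVC(R(B), D) ≤ EVC(R(G ∪ W), D)` and `VC(R(B)) ≤ VC(R(G ∪ W))`. -/
theorem stmt14 {α : Type*} [Fintype α] [DecidableEq α] (π : Measure (Finset α))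
    [IsProbabilityMeasure π] (D : Multiset (Finset α)) (hD : D ≠ 0)
    (θ ε₁ : ℝ) (hθ0 : 0 < θ) (hθ1 : θ ≤ 1) (hε0 : 0 < ε₁) (hεθ : ε₁ < θ)
    (B G W : Set (Finset α))
    (hB : B = negBorder (TFI π θ))
    (hG : G = {A : Finset α | θ - ε₁ ≤ freq D A ∧ freq D A < θ + ε₁})
    (hW : W = negBorder (FI D (θ - ε₁)))
    (happrox : ∀ A : Finset α, |trueFreq π A - freq D A| ≤ ε₁) :
    B ⊆ G ∪ W ∧ EVC (rangeSet B) D ≤ EVC (rangeSet (G ∪ W)) D ∧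
      VCdim (rangeSet B) ≤ VCdim (rangeSet (G ∪ W)) := by
  subst hB hG hW
  have hsub := negBorder_TFI_subset (θ := θ) happrox
  exact ⟨hsub, EVC_mono (rangeSet_mono hsub) D, VCdim_mono (rangeSet_mono hsub)⟩
end

section
/- Let π be a probability distribution on 2^I for a finite ground set I, let D be a dataset, let θ ∈ (0,1] and ε ∈ (0,1), and let B be the negative border of TFI(π, I, θ). If D is an ε-approximation to (R(B), π), i.e., |t_π(A) − f_D(A)| ≤ ε for every A ∈ B, then FI(D, I, θ+ε) ⊆ TFI(π, I, θ): every itemset whose frequency in D is at least θ + ε has true frequency at least θ. -/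
open MeasureTheory

theorem exists_mem_negBorder_subset {α : Type*} {T : Set (Finset α)} {A : Finset α}
    (hA : A ∉ T) : ∃ B ∈ negBorder T, B ⊆ A := by
  induction A using Finset.strongInduction with
  | H A ih =>
    by_cases h : ∀ B, B ⊂ A → B ∈ T
    · exact ⟨A, ⟨hA, h⟩, subset_rfl⟩
    · push Not at h
      obtain ⟨B, hBA, hB⟩ := h
      obtain ⟨C, hC, hCB⟩ := ih B hBA hB
      exact ⟨C, hC, hCB.trans hBA.subset⟩

theorem freq_anti {α : Type*} [DecidableEq α] (D : Multiset (Finset α)) :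
    Antitone (freq D) := by
  intro A B hAB
  unfold freq
  gcongr
  exact Multiset.monotone_filter_right D fun τ h => hAB.trans h

/-- Let `B` be the negative border of `TFI(π, I, θ)`. If `D` is an
`ε`-approximation to `(R(B), π)`, i.e. `|t_π(A) − f_D(A)| ≤ ε` for every `A ∈ B`, then
`FI(D, I, θ+ε) ⊆ TFI(π, I, θ)`. -/
theorem stmt15 {α : Type*} [Fintype α] [DecidableEq α] (π : Measure (Finset α))
    [IsProbabilityMeasure π] (D : Multiset (Finset α)) (hD : D ≠ 0)
    (θ ε : ℝ) (hθ0 : 0 < θ) (hθ1 : θ ≤ 1) (hε0 : 0 < ε) (hε1 : ε < 1)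
    (happrox : ∀ A ∈ negBorder (TFI π θ), |trueFreq π A - freq D A| ≤ ε) :
    FI D (θ + ε) ⊆ TFI π θ := by
  intro A hA
  by_contra hAT
  obtain ⟨B, hB, hBA⟩ := exists_mem_negBorder_subset hAT
  have hfreq : θ + ε ≤ freq D B := le_trans hA (freq_anti D hBA)
  have htrue : trueFreq π B < θ := not_le.mp hB.1
  linarith [(abs_le.mp (happrox B hB)).1]
end

section
/- Let π be a probability distribution on 2^I for a finite ground set I, let θ ∈ (0,1], ε ∈ (0,1), δ ∈ (0,1), and let B be the negative border of TFI(π, I, θ). Let D be a random dataset of n transactions drawn independently and identically distributed from π. If with probability at least 1 − δ the dataset D is an ε-approximation to (R(B), π), then the Family-Wise Error Rate of reporting FI(D, I, θ+ε) is at most δ: the probability that there exists an itemset A ∈ FI(D, I, θ+ε) with t_π(A) < θ is at most δ. -/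
open MeasureTheory

/-- The frequency of an itemset `A` in a dataset `D = (τ_1, …, τ_n)` of `n` transactions:
the fraction of transactions of `D` containing `A`. -/
noncomputable def freqF {α : Type*} [DecidableEq α] {n : ℕ} (D : Fin n → Finset α)
    (A : Finset α) : ℝ :=
  (1 / (n : ℝ)) * ∑ j : Fin n, (if A ⊆ D j then (1 : ℝ) else 0)

/-- Frequency in a dataset is antitone in the itemset. -/
theorem freqF_anti {α : Type*} [DecidableEq α] {n : ℕ} (D : Fin n → Finset α)
    {A B : Finset α} (h : B ⊆ A) : freqF D A ≤ freqF D B := by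
  unfold freqF
  refine mul_le_mul_of_nonneg_left (Finset.sum_le_sum fun j _ => ?_) (by positivity)
  split_ifs with h1 h2 h2
  · exact le_rfl
  · exact absurd (h.trans h1) h2
  · exact zero_le_one
  · exact le_rfl

/-- Every itemset outside a collection contains a member of its negative border. -/
theorem exists_subset_mem_negBorder {α : Type*} {T : Set (Finset α)} {A : Finset α}
    (hA : A ∉ T) : ∃ B ⊆ A, B ∈ negBorder T := by
  induction A using Finset.strongInduction with
  | H A ih =>
    by_cases h : ∀ B, B ⊂ A → B ∈ T
    · exact ⟨A, subset_rfl, hA, h⟩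
    · push Not at h
      obtain ⟨B, hBA, hB⟩ := h
      obtain ⟨C, hCB, hC⟩ := ih B hBA hB
      exact ⟨C, hCB.trans hBA.subset, hC⟩

/-- Let `B` be the negative border of `TFI(π, I, θ)` and let `D` be a random
dataset of `n` transactions drawn i.i.d. from `π` (i.e. distributed as the `n`-fold
product of `π`). If with probability at least `1 − δ` the dataset `D` is an
`ε`-approximation to `(R(B), π)`, then the Family-Wise Error Rate of reporting
`FI(D, I, θ+ε)` is at most `δ`: the probability that some itemset `A` with frequency at
least `θ + ε` in `D` has true frequency `t_π(A) < θ` is at most `δ`. -/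
theorem stmt19 {α : Type*} [Fintype α] [DecidableEq α] (π : Measure (Finset α))
    [IsProbabilityMeasure π] (θ ε δ : ℝ) (hθ0 : 0 < θ) (hθ1 : θ ≤ 1)
    (hε0 : 0 < ε) (hε1 : ε < 1) (hδ0 : 0 < δ) (hδ1 : δ < 1) (n : ℕ) (hn : 0 < n)
    (happrox : (Measure.pi fun _ : Fin n => π)
        {D | ∀ A ∈ negBorder (TFI π θ), |trueFreq π A - freqF D A| ≤ ε} ≥
      ENNReal.ofReal (1 - δ)) :
    (Measure.pi fun _ : Fin n => π)
      {D | ∃ A : Finset α, θ + ε ≤ freqF D A ∧ trueFreq π A < θ} ≤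
      ENNReal.ofReal δ := by
  have : DiscreteMeasurableSpace (Finset α) := ⟨fun _ => trivial⟩
  set μ := Measure.pi fun _ : Fin n => π
  set G : Set (Fin n → Finset α) :=
    {D | ∀ A ∈ negBorder (TFI π θ), |trueFreq π A - freqF D A| ≤ ε}
  have hsub : {D : Fin n → Finset α | ∃ A : Finset α, θ + ε ≤ freqF D A ∧ trueFreq π A < θ} ⊆
      Gᶜ := by
    rintro D ⟨A, hfA, htA⟩ hD
    obtain ⟨B, hBA, hB⟩ := exists_subset_mem_negBorder (T := TFI π θ) (not_le.mpr htA)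
    have htB : trueFreq π B < θ := not_le.mp hB.1
    have hfB := freqF_anti D hBA
    have := (abs_le.mp (hD B hB)).1
    linarith
  have hG : MeasurableSet G := (Set.toFinite G).measurableSet
  calc μ _ ≤ μ Gᶜ := measure_mono hsub
    _ = 1 - μ G := prob_compl_eq_one_sub hG
    _ ≤ 1 - ENNReal.ofReal (1 - δ) := tsub_le_tsub_left happrox 1
    _ = ENNReal.ofReal δ := by
      rw [← ENNReal.ofReal_one, ← ENNReal.ofReal_sub 1 (by linarith), sub_sub_cancel]
end
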